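/- Let m ≥ 1, let A : ℝ → Matrix (Fin m) (Fin m) ℝ take values in symmetric matrices, and suppose A is differentiable at t₀ with derivative A′ (a symmetric m×m matrix). Then for every 1 ≤ k ≤ m, the function t ↦ S_k(A(t)) is differentiable at t₀ with derivative tr(P_{k−1}(A(t₀)) · A′). (This is the identity (S_k)' = ⟨P_{k−1}, A'⟩ underlying the formula for the divergence of the Newton operators of a Codazzi tensor.) -/

import Mathlib

/-- `symFun M k` is the `k`-th elementary symmetric function of the eigenvalues
(with multiplicity) of the real `m×m` matrix `M`, i.e. `(−1)^k` times the
coefficient of `X^(m−k)` in the characteristic polynomial `det (X·I − M)`. -/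
noncomputable def symFun {m : ℕ} (M : Matrix (Fin m) (Fin m) ℝ) (k : ℕ) : ℝ :=
  (-1 : ℝ) ^ k * (M.charpoly.coeff (m - k))

/-- The Newton operators of `M`: `P₀(M) = I` and
`P_k(M) = S_k(M)·I − M·P_{k−1}(M)`. -/
noncomputable def newtonOp {m : ℕ} (M : Matrix (Fin m) (Fin m) ℝ) :
    ℕ → Matrix (Fin m) (Fin m) ℝ
  | 0 => 1
  | k + 1 => symFun M (k + 1) • (1 : Matrix (Fin m) (Fin m) ℝ) - M * newtonOp M k

open Polynomial in
/-- The coefficients of the curve of polynomials `p` have the coefficients of `p'` as their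
derivatives at `t₀`. -/
def HasCoeffDerivAt (p : ℝ → ℝ[X]) (p' : ℝ[X]) (t₀ : ℝ) : Prop :=
  ∀ n, HasDerivAt (fun t => (p t).coeff n) (p'.coeff n) t₀

namespace HasCoeffDerivAt

open Polynomial

variable {t₀ : ℝ}

theorem const (p : ℝ[X]) : HasCoeffDerivAt (fun _ => p) 0 t₀ := fun n => by
  simpa using hasDerivAt_const t₀ (p.coeff n)

theorem mul {p q : ℝ → ℝ[X]} {p' q' : ℝ[X]} (hp : HasCoeffDerivAt p p' t₀)
    (hq : HasCoeffDerivAt q q' t₀) :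
    HasCoeffDerivAt (fun t => p t * q t) (p' * q t₀ + p t₀ * q') t₀ := fun n => by
  simp only [coeff_add, coeff_mul, ← Finset.sum_add_distrib]
  exact HasDerivAt.fun_sum fun x _ => (hp x.1).mul (hq x.2)

theorem sum {ι : Type*} {s : Finset ι} {p : ι → ℝ → ℝ[X]} {p' : ι → ℝ[X]}
    (h : ∀ i ∈ s, HasCoeffDerivAt (p i) (p' i) t₀) :
    HasCoeffDerivAt (fun t => ∑ i ∈ s, p i t) (∑ i ∈ s, p' i) t₀ := fun n => by
  simp only [finsetSum_coeff]
  exact HasDerivAt.fun_sum fun i hi => h i hi n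

theorem prod {ι : Type*} [DecidableEq ι] {s : Finset ι} {p : ι → ℝ → ℝ[X]} {p' : ι → ℝ[X]}
    (h : ∀ i ∈ s, HasCoeffDerivAt (p i) (p' i) t₀) :
    HasCoeffDerivAt (fun t => ∏ i ∈ s, p i t)
      (∑ i ∈ s, (∏ j ∈ s.erase i, p j t₀) * p' i) t₀ := by
  induction s using Finset.induction_on with
  | empty => simpa using const (t₀ := t₀) 1
  | insert a s ha ih =>
    have key := (h a (Finset.mem_insert_self a s)).mul
      (ih fun i hi => h i (Finset.mem_insert_of_mem hi))
    simp only [Finset.prod_insert ha]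
    convert key using 1
    rw [Finset.sum_insert ha, Finset.erase_insert ha, mul_comm, Finset.mul_sum]
    congr 1
    refine Finset.sum_congr rfl fun i hi => ?_
    rw [Finset.erase_insert_of_ne (by rintro rfl; exact ha hi),
      Finset.prod_insert fun h => ha (Finset.mem_of_mem_erase h), mul_assoc]

/-- Jacobi's formula, coefficient by coefficient. -/
theorem det {n : Type*} [Fintype n] [DecidableEq n] {M : ℝ → Matrix n n ℝ[X]}
    {M' : Matrix n n ℝ[X]} (h : ∀ i j, HasCoeffDerivAt (fun t => M t i j) (M' i j) t₀) :
    HasCoeffDerivAt (fun t => (M t).det) (((M t₀).adjugate * M').trace) t₀ := by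
  have hdet : HasCoeffDerivAt (fun t => (M t).det)
      (∑ σ : Equiv.Perm n, ((Equiv.Perm.sign σ : ℤ) : ℝ[X]) *
        ∑ i, (∏ j ∈ Finset.univ.erase i, M t₀ (σ j) j) * M' (σ i) i) t₀ := by
    simp only [Matrix.det_apply']
    refine sum fun σ _ => ?_
    simpa using (const ((Equiv.Perm.sign σ : ℤ) : ℝ[X])).mul
      (prod (s := Finset.univ) fun i _ => h (σ i) i)
  convert hdet using 1
  have hcol (i : n) : ((M t₀).adjugate * M') i i = ((M t₀).updateCol i (M'.col i)).det := by
    rw [← Matrix.cramer_apply, Matrix.cramer_eq_adjugate_mulVec]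
    rfl
  simp only [Matrix.trace, Matrix.diag_apply, hcol, Matrix.det_apply', Finset.mul_sum]
  rw [Finset.sum_comm]
  refine Finset.sum_congr rfl fun σ _ => Finset.sum_congr rfl fun i _ => ?_
  rw [← Finset.prod_erase_mul _ _ (Finset.mem_univ i)]
  congr 2
  · refine Finset.prod_congr rfl fun j hj => ?_
    rw [Matrix.updateCol_ne (Finset.ne_of_mem_erase hj)]
  · simp [Matrix.col]

end HasCoeffDerivAt

section AdjugateCharmatrix

open Polynomial

variable {n R : Type*} [Fintype n] [DecidableEq n] [CommRing R]

theorem X_sub_C_mul_matPolyEquiv_adjugate_charmatrix (M : Matrix n n R) :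
    (X - C M) * matPolyEquiv M.charmatrix.adjugate =
      M.charpoly.map (algebraMap R (Matrix n n R)) := by
  rw [← Matrix.matPolyEquiv_charmatrix, ← map_mul, Matrix.mul_adjugate, ← Matrix.charpoly,
    matPolyEquiv_smul_one]

theorem coeff_matPolyEquiv_adjugate_charmatrix (M : Matrix n n R) (k : ℕ) :
    (matPolyEquiv M.charmatrix.adjugate).coeff k =
      M.charpoly.coeff (k + 1) • 1 + M * (matPolyEquiv M.charmatrix.adjugate).coeff (k + 1) := by
  have h := congrArg (coeff · (k + 1)) (X_sub_C_mul_matPolyEquiv_adjugate_charmatrix M)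
  simp only [sub_mul, coeff_sub, coeff_X_mul, coeff_C_mul, coeff_map,
    Algebra.algebraMap_eq_smul_one] at h
  exact sub_eq_iff_eq_add.mp h

theorem coeff_matPolyEquiv_adjugate_charmatrix_card (M : Matrix n n R) :
    (matPolyEquiv M.charmatrix.adjugate).coeff (Fintype.card n) = 0 := by
  nontriviality R
  cases isEmpty_or_nonempty n
  · exact Subsingleton.elim _ _
  by_cases h0 : matPolyEquiv M.charmatrix.adjugate = 0
  · simp [h0]
  refine coeff_eq_zero_of_natDegree_lt ?_
  have h := congrArg natDegree (X_sub_C_mul_matPolyEquiv_adjugate_charmatrix M)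
  rw [(monic_X_sub_C M).natDegree_mul' h0, natDegree_X_sub_C] at h
  have hle := natDegree_map_le (f := algebraMap R (Matrix n n R)) (p := M.charpoly)
  rw [M.charpoly_natDegree_eq_dim] at hle
  omega

end AdjugateCharmatrix

theorem coeff_matPolyEquiv_adjugate_charmatrix_eq_newtonOp {m : ℕ}
    (M : Matrix (Fin m) (Fin m) ℝ) (k : ℕ) (hk : k < m) :
    (matPolyEquiv M.charmatrix.adjugate).coeff (m - (k + 1)) = (-1 : ℝ) ^ k • newtonOp M k := by
  induction k with
  | zero =>
    have hc : M.charpoly.coeff m = 1 := by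
      simpa [M.charpoly_natDegree_eq_dim] using M.charpoly_monic.coeff_natDegree
    have hz : (matPolyEquiv M.charmatrix.adjugate).coeff m = 0 := by
      simpa using coeff_matPolyEquiv_adjugate_charmatrix_card M
    rw [coeff_matPolyEquiv_adjugate_charmatrix, show m - (0 + 1) + 1 = m by omega, hc, hz]
    simp [newtonOp]
  | succ k ih =>
    rw [coeff_matPolyEquiv_adjugate_charmatrix,
      show m - (k + 1 + 1) + 1 = m - (k + 1) by omega, ih (by omega), newtonOp, symFun,
      smul_sub, smul_smul, ← mul_assoc, ← mul_pow, pow_succ (-1 : ℝ) k, Matrix.mul_smul]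
    simp

/-- If `t ↦ A t` is a curve of symmetric matrices differentiable at `t₀` with
symmetric derivative `A'`, then for `1 ≤ k ≤ m` the function `t ↦ S_k(A t)` is
differentiable at `t₀` with derivative `tr (P_{k−1}(A t₀) · A')`. -/
theorem hasDerivAt_symFun (m : ℕ) (hm : 1 ≤ m) (t₀ : ℝ)
    (A : ℝ → Matrix (Fin m) (Fin m) ℝ) (A' : Matrix (Fin m) (Fin m) ℝ)
    (hsymm : ∀ t, (A t).IsSymm) (hA'symm : A'.IsSymm)
    (hderiv : ∀ i j, HasDerivAt (fun t => A t i j) (A' i j) t₀)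
    (k : ℕ) (hk1 : 1 ≤ k) (hk2 : k ≤ m) :
    HasDerivAt (fun t => symFun (A t) k)
      (Matrix.trace (newtonOp (A t₀) (k - 1) * A')) t₀ := by
  have hchar (i j : Fin m) : HasCoeffDerivAt (fun t => (A t).charmatrix i j)
      ((-A'.map Polynomial.C) i j) t₀ := fun n => by
    simp only [Matrix.charmatrix_apply, Matrix.neg_apply, Matrix.map_apply,
      Polynomial.coeff_sub, Polynomial.coeff_neg, Polynomial.coeff_C]
    split_ifs
    · exact (hderiv i j).const_sub _
    · simpa using hasDerivAt_const t₀ _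
  have hcoeff := (HasCoeffDerivAt.det hchar (m - k)).const_mul ((-1 : ℝ) ^ k)
  refine hcoeff.congr_deriv (Eq.symm ?_)
  obtain ⟨k, rfl⟩ := Nat.exists_eq_add_of_le' hk1
  have hadj := coeff_matPolyEquiv_adjugate_charmatrix_eq_newtonOp (A t₀) k hk2
  have htrace : (((A t₀).charmatrix.adjugate * -A'.map Polynomial.C).trace).coeff (m - (k + 1)) =
      -((matPolyEquiv (A t₀).charmatrix.adjugate).coeff (m - (k + 1)) * A').trace := by
    simp [Matrix.trace, Matrix.mul_apply, matPolyEquiv_coeff_apply]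
  have hsign : (-1 : ℝ) ^ k * (-1) ^ k = 1 := by simp [← mul_pow]
  rw [htrace, hadj, Matrix.smul_mul, Matrix.trace_smul, smul_eq_mul, Nat.add_sub_cancel]
  linear_combination -(newtonOp (A t₀) k * A').trace * hsign
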